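/- For every horizon T ≥ 0 and every fixed belief state ω ∈ [0,1], the map m ↦ V_{T,m}(ω) is a convex function of the subsidy m on ℝ. -/

import Mathlib

/-- One-step belief update without observation: `T(ω) = ω·p11 + (1−ω)·p01`. -/
noncomputable def Tmap (p01 p11 ω : ℝ) : ℝ := ω * p11 + (1 - ω) * p01

/-- Belief update after a failed observation: `φ(ω) = εω/(εω + 1 − ω)`. -/
noncomputable def phi (ε ω : ℝ) : ℝ := ε * ω / (ε * ω + 1 - ω)

/-- Finite-horizon value function `V_T` of the single-armed bandit with subsidy `m`:
`V_0 ≡ 0` and `V_T(ω) = max{V_T(ω;u=1), V_T(ω;u=0)}`. -/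
noncomputable def Vfin (p01 p11 ε β m : ℝ) : ℕ → ℝ → ℝ
  | 0, _ => 0
  | T + 1, ω =>
      max ((1 - ε) * ω + β * ((1 - ε) * ω * Vfin p01 p11 ε β m T p11
            + (1 - (1 - ε) * ω) * Vfin p01 p11 ε β m T (Tmap p01 p11 (phi ε ω))))
          (m + β * Vfin p01 p11 ε β m T (Tmap p01 p11 ω))


/-- `T` maps `[0,1]` into itself. -/
lemma Tmap_mem_Icc {p01 p11 ω : ℝ} (hp01 : p01 ∈ Set.Icc (0:ℝ) 1)
    (hp11 : p11 ∈ Set.Icc (0:ℝ) 1) (hω : ω ∈ Set.Icc (0:ℝ) 1) :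
    Tmap p01 p11 ω ∈ Set.Icc (0:ℝ) 1 :=
  convex_Icc (0:ℝ) 1 hp11 hp01 hω.1 (sub_nonneg.2 hω.2) (by ring)

/-- `φ` maps `[0,1]` into itself. -/
lemma phi_mem_Icc {ε ω : ℝ} (hε : 0 ≤ ε) (hω : ω ∈ Set.Icc (0:ℝ) 1) :
    phi ε ω ∈ Set.Icc (0:ℝ) 1 := by
  have hnum : 0 ≤ ε * ω := mul_nonneg hε hω.1
  have hden : ε * ω ≤ ε * ω + 1 - ω := by linarith [hω.2]
  exact ⟨div_nonneg hnum (hnum.trans hden), div_le_one_of_le₀ hden (hnum.trans hden)⟩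

/-- For every horizon `T` and belief state `ω ∈ [0,1]`, the finite-horizon value
`V_{T,m}(ω)` is a convex function of the subsidy `m` on `ℝ`. -/
theorem Vfin_convexOn_subsidy (p01 p11 ε β : ℝ)
    (hp01 : p01 ∈ Set.Ioo (0:ℝ) 1) (hp11 : p11 ∈ Set.Ioo (0:ℝ) 1)
    (hne : p01 ≠ p11) (hε : ε ∈ Set.Ioo (0:ℝ) 1) (hβ : β ∈ Set.Ioo (0:ℝ) 1) :
    ∀ T : ℕ, ∀ ω ∈ Set.Icc (0:ℝ) 1,
      ConvexOn ℝ Set.univ (fun m : ℝ => Vfin p01 p11 ε β m T ω) := by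
  intro T
  induction T with
  | zero =>
    intro ω _
    simpa only [Vfin] using convexOn_const (0:ℝ) convex_univ
  | succ T ih =>
    intro ω hω
    have hTmap {x : ℝ} (hx : x ∈ Set.Icc (0:ℝ) 1) : Tmap p01 p11 x ∈ Set.Icc (0:ℝ) 1 :=
      Tmap_mem_Icc (Set.Ioo_subset_Icc_self hp01) (Set.Ioo_subset_Icc_self hp11) hx
    have hsuccess : 0 ≤ (1 - ε) * ω := mul_nonneg (sub_nonneg.2 hε.2.le) hω.1
    have hfailure : 0 ≤ 1 - (1 - ε) * ω :=
      sub_nonneg.2 (mul_le_one₀ (by linarith [hε.1]) hω.1 hω.2)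
    have hactive := (convexOn_const ((1 - ε) * ω) convex_univ).add
      ((((ih p11 (Set.Ioo_subset_Icc_self hp11)).smul hsuccess).add
        ((ih _ (hTmap (phi_mem_Icc hε.1.le hω))).smul hfailure)).smul hβ.1.le)
    have hpassive := (convexOn_id convex_univ).add ((ih _ (hTmap hω)).smul hβ.1.le)
    simp only [Vfin]
    exact hactive.sup hpassive
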